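/- Let M be a simple planar graph on n ≥ 3 vertices that has an independent set I₂ consisting of n₂ vertices all of degree 2 in M. Then M has at most (3n−6) − (n₂−1) edges. -/

import Mathlib

/-- A simple graph is planar if it has a drawing in the plane: an injective placement
of the vertices together with a simple arc for each edge, such that arcs for distinct
edges meet only in common endpoints and no arc passes through another vertex. -/
def SimpleGraph.IsPlanar {V : Type*} (G : SimpleGraph V) : Prop :=
  ∃ (p : V → ℝ × ℝ) (a : ∀ u v : V, G.Adj u v → _root_.Path (p u) (p v)),
    Function.Injective p ∧
    (∀ u v (h : G.Adj u v), Function.Injective ⇑(a u v h)) ∧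
    (∀ u v (h : G.Adj u v), (a u v h).symm = a v u h.symm) ∧
    (∀ u v (h : G.Adj u v) (w : V), p w ∈ Set.range ⇑(a u v h) → w = u ∨ w = v) ∧
    (∀ u v (h : G.Adj u v) u' v' (h' : G.Adj u' v'), s(u, v) ≠ s(u', v') →
      Set.range ⇑(a u v h) ∩ Set.range ⇑(a u' v' h') ⊆ ({p u, p v} : Set (ℝ × ℝ)) ∩ {p u', p v'})

section LogVariation
open unitInterval

/-- `L` is the variation of a continuous logarithm along `γ`. -/
def IsLogVar (γ : I → ℂ) (L : ℂ) : Prop :=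
  ∃ g : I → ℂ, Continuous g ∧ (∀ t, Complex.exp (g t) = γ t) ∧ g 1 - g 0 = L

theorem IsLogVar.unique {γ : I → ℂ} {L L' : ℂ} (h : IsLogVar γ L) (h' : IsLogVar γ L') :
    L = L' := by
  obtain ⟨g, hg, hgγ, rfl⟩ := h
  obtain ⟨k, hk, hkγ, rfl⟩ := h'
  have key := Complex.isCoveringMap_exp.eq_of_comp_eq (g₁ := g)
    (g₂ := fun t => k t + (g 0 - k 0)) hg (by fun_prop) (by
      funext t
      apply Subtype.ext
      have h0 : Complex.exp (g 0 - k 0) = 1 := by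
        rw [Complex.exp_sub, hgγ, hkγ, div_self]
        rw [← hkγ]; exact Complex.exp_ne_zero _
      simp [Complex.exp_add, h0, hgγ, hkγ]) 0 (by simp)
  have := congrFun key 1
  rw [this]; ring

theorem IsLogVar.neg {γ : I → ℂ} {L : ℂ} (h : IsLogVar γ L) : IsLogVar (fun t => - γ t) L := by
  obtain ⟨g, hg, hgγ, rfl⟩ := h
  refine ⟨fun t => g t + Real.pi * Complex.I, by fun_prop, fun t => ?_, by ring⟩
  rw [Complex.exp_add, hgγ, Complex.exp_pi_mul_I]; ring

theorem exists_log_square (F : C(I × I, ℂ)) (hF : ∀ x, F x ≠ 0) :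
    ∃ G : C(I × I, ℂ), ∀ x, Complex.exp (G x) = F x := by
  have hI : (0 : ℝ) ≤ 1 := zero_le_one
  let F' : C(ℝ × ℝ, ℂ) := ⟨fun x => F (Set.projIcc 0 1 hI x.1, Set.projIcc 0 1 hI x.2), by
    have := continuous_projIcc (h := hI)
    fun_prop⟩
  obtain ⟨G, hG, -⟩ := Complex.isCoveringMapOn_exp.existsUnique_continuousMap_lifts F'
    (a₀ := (0, 0)) (e₀ := Complex.log (F' (0, 0)))
    (Complex.exp_log (hF _)) (fun x => hF _)
  refine ⟨⟨fun x => G (x.1, x.2), by fun_prop⟩, fun x => ?_⟩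
  have := congrFun hG.2 (x.1, x.2)
  simpa [F'] using this

theorem exists_isLogVar (γ : I → ℂ) (hγ : Continuous γ) (h0 : ∀ t, γ t ≠ 0) :
    ∃ L, IsLogVar γ L := by
  obtain ⟨G, hG⟩ := exists_log_square ⟨fun x => γ x.1, by fun_prop⟩ (fun x => h0 x.1)
  exact ⟨_, fun t => G (t, 0), by fun_prop, fun t => hG (t, 0), rfl⟩

/-- The relation coming from a pair of disjoint arcs. -/
theorem square_relation {f g : I → ℂ} (hf : Continuous f) (hg : Continuous g)
    (hfg : ∀ s t, f s ≠ g t) {A B C D : ℂ}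
    (hA : IsLogVar (fun s => f s - g 0) A) (hB : IsLogVar (fun s => f s - g 1) B)
    (hC : IsLogVar (fun t => g t - f 0) C) (hD : IsLogVar (fun t => g t - f 1) D) :
    A + D = B + C := by
  obtain ⟨G, hG⟩ := exists_log_square ⟨fun x => f x.1 - g x.2, by fun_prop⟩
    (fun x => sub_ne_zero.2 (hfg x.1 x.2))
  have eA := hA.unique ⟨fun s => G (s, 0), by fun_prop, fun t => hG (t, 0), rfl⟩
  have eB := hB.unique ⟨fun s => G (s, 1), by fun_prop, fun t => hG (t, 1), rfl⟩
  have eC := hC.neg.unique ⟨fun s => G (0, s), by fun_prop, fun t => by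
    rw [hG (0, t)]; simp, rfl⟩
  have eD := hD.neg.unique ⟨fun s => G (1, s), by fun_prop, fun t => by
    rw [hG (1, t)]; simp, rfl⟩
  rw [eA, eB, eC, eD]; ring

theorem no_k5 (p : Fin 5 → ℂ) (a : ∀ i j, i < j → Path (p i) (p j))
    (h : ∀ i j k l (hij : i < j) (hkl : k < l), i ≠ k → i ≠ l → j ≠ k → j ≠ l →
      ∀ s t, a i j hij s ≠ a k l hkl t) : False := by
  have hpt : ∀ i j k (hij : i < j), k ≠ i → k ≠ j → ∀ s, a i j hij s ≠ p k := by
    intro i j k hij hki hkj s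
    obtain ⟨l, hli, hlj, hlk⟩ : ∃ l : Fin 5, l ≠ i ∧ l ≠ j ∧ l ≠ k := by
      clear h a
      revert i j k; decide
    rcases lt_or_gt_of_ne hlk with hl | hl
    · have := h i j l k hij hl hli.symm hki.symm hlj.symm hkj.symm s 1
      rwa [Path.target] at this
    · have := h i j k l hij hl hki.symm hli.symm hkj.symm hlj.symm s 0
      rwa [Path.source] at this
  have hinj : ∀ i j, i ≠ j → p i ≠ p j := by
    intro i j hij
    obtain ⟨l, hli, hlj⟩ : ∃ l : Fin 5, l ≠ i ∧ l ≠ j := by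
      clear hpt h a
      revert i j; decide
    rcases lt_or_gt_of_ne hli with hl | hl
    · have := hpt l i j hl hlj.symm hij.symm 1
      rwa [Path.target] at this
    · have := hpt i l j hl hij.symm hlj.symm 0
      rwa [Path.source] at this
  obtain ⟨ε, hε⟩ : ∃ ε : Fin 5 → Fin 5 → ℤ, ε = fun k j => if k < j then -1 else 1 := ⟨_, rfl⟩
  obtain ⟨l, hl⟩ : ∃ l : Fin 5 → Fin 5 → ℂ, l = fun k j => if k < j then Complex.log (p j - p k)
    else Complex.log (p k - p j) + Real.pi * Complex.I := ⟨_, rfl⟩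
  have hlexp : ∀ k j, k ≠ j → Complex.exp (l k j) = p j - p k := by
    intro k j hkj
    have h1 := sub_ne_zero.2 (hinj k j hkj)
    have h2 := sub_ne_zero.2 (hinj j k hkj.symm)
    rw [hl]
    dsimp only
    split_ifs
    · rw [Complex.exp_log h2]
    · rw [Complex.exp_add, Complex.exp_log h1, Complex.exp_pi_mul_I]; ring
  have hlε : ∀ k j, k ≠ j → l k j - l j k = Real.pi * Complex.I * ε k j := by
    intro k j hkj
    rw [hl, hε]
    dsimp only
    rcases lt_or_gt_of_ne hkj with h1 | h1
    · simp [h1, h1.not_gt]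
    · simp [h1, h1.not_gt]
  have hm : ∀ k i j, ∃ m : ℤ, ∀ hij : i < j, k ≠ i → k ≠ j →
      IsLogVar (fun t => a i j hij t - p k)
        (l k j - l k i + 2 * Real.pi * Complex.I * m) := by
    intro k i j
    by_cases hc : i < j ∧ k ≠ i ∧ k ≠ j
    · obtain ⟨hij, hki, hkj⟩ := hc
      obtain ⟨L, hL⟩ := exists_isLogVar (fun t => a i j hij t - p k) (by fun_prop)
        (fun t => sub_ne_zero.2 (hpt i j k hij hki hkj t))
      have hL' := hL
      obtain ⟨g, hg, hgγ, rfl⟩ := hL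
      have : Complex.exp (g 1 - g 0) = Complex.exp (l k j - l k i) := by
        rw [Complex.exp_sub, Complex.exp_sub, hgγ, hgγ, hlexp k j hkj, hlexp k i hki]
        simp
      obtain ⟨m, hm⟩ := Complex.exp_eq_exp_iff_exists_int.1 this
      refine ⟨m, fun _ _ _ => ?_⟩
      rw [hm] at hL'
      convert hL' using 1
      ring
    · exact ⟨0, fun h1 h2 h3 => absurd ⟨h1, h2, h3⟩ hc⟩
  choose m hm using hm
  have rel : ∀ i j k n, i < j → k < n → i ≠ k → i ≠ n → j ≠ k → j ≠ n →
      ε k j - ε k i - ε n j + ε n i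
        + 2 * (m k i j - m n i j + m j k n - m i k n) = 0 := by
    intro i j k n hij hkn hik hin hjk hjn
    have hA := hm k i j hij hik.symm hjk.symm
    have hB := hm n i j hij hin.symm hjn.symm
    have hC := hm i k n hkn hik hin
    have hD := hm j k n hkn hjk hjn
    have := square_relation (f := a i j hij) (g := a k n hkn) (by fun_prop) (by fun_prop)
      (h i j k n hij hkn hik hin hjk hjn)
      (by simpa using hA) (by simpa using hB) (by simpa using hC) (by simpa using hD)
    have e1 := hlε k j hjk.symm
    have e2 := hlε k i hik.symm
    have e3 := hlε n j hjn.symm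
    have e4 := hlε n i hin.symm
    have hpi : (Real.pi * Complex.I : ℂ) ≠ 0 := by
      simp [Real.pi_ne_zero]
    have : (Real.pi * Complex.I : ℂ) * ((ε k j - ε k i - ε n j + ε n i
        + 2 * (m k i j - m n i j + m j k n - m i k n) : ℤ) : ℂ) = 0 := by
      push_cast
      linear_combination this - e1 + e2 + e3 - e4
    rcases mul_eq_zero.1 this with h1 | h1
    · exact absurd h1 hpi
    · exact_mod_cast h1
  have r1 := rel 0 1 2 3 (by decide) (by decide) (by decide) (by decide) (by decide) (by decide)
  have r2 := rel 0 2 1 3 (by decide) (by decide) (by decide) (by decide) (by decide) (by decide)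
  have r3 := rel 0 3 1 2 (by decide) (by decide) (by decide) (by decide) (by decide) (by decide)
  have r4 := rel 0 1 2 4 (by decide) (by decide) (by decide) (by decide) (by decide) (by decide)
  have r5 := rel 0 2 1 4 (by decide) (by decide) (by decide) (by decide) (by decide) (by decide)
  have r6 := rel 0 4 1 2 (by decide) (by decide) (by decide) (by decide) (by decide) (by decide)
  have r7 := rel 0 1 3 4 (by decide) (by decide) (by decide) (by decide) (by decide) (by decide)
  have r8 := rel 0 3 1 4 (by decide) (by decide) (by decide) (by decide) (by decide) (by decide)
  have r9 := rel 0 4 1 3 (by decide) (by decide) (by decide) (by decide) (by decide) (by decide)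
  have r10 := rel 0 2 3 4 (by decide) (by decide) (by decide) (by decide) (by decide) (by decide)
  have r11 := rel 0 3 2 4 (by decide) (by decide) (by decide) (by decide) (by decide) (by decide)
  have r12 := rel 0 4 2 3 (by decide) (by decide) (by decide) (by decide) (by decide) (by decide)
  have r13 := rel 1 2 3 4 (by decide) (by decide) (by decide) (by decide) (by decide) (by decide)
  have r14 := rel 1 3 2 4 (by decide) (by decide) (by decide) (by decide) (by decide) (by decide)
  have r15 := rel 1 4 2 3 (by decide) (by decide) (by decide) (by decide) (by decide) (by decide)
  clear rel hm hlε hlexp hl hinj hpt h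
  subst hε
  simp at r1 r2 r3 r4 r5 r6 r7 r8 r9 r10 r11 r12 r13 r14 r15
  omega

end LogVariation

/-- A weak form of planarity: disjoint edges can be drawn as disjoint curves. -/
def AlmostPlanar {V : Type*} (G : SimpleGraph V) : Prop :=
  ∃ (p : V → ℂ) (a : ∀ u v : V, G.Adj u v → _root_.Path (p u) (p v)),
    ∀ u v (h : G.Adj u v) x y (h' : G.Adj x y), u ≠ x → u ≠ y → v ≠ x → v ≠ y →
      Disjoint (Set.range (a u v h)) (Set.range (a x y h'))

theorem AlmostPlanar.mono {V : Type*} {G H : SimpleGraph V} (hG : AlmostPlanar G) (h : H ≤ G) :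
    AlmostPlanar H := by
  obtain ⟨p, a, ha⟩ := hG
  exact ⟨p, fun u v e => a u v (h e), fun u v e x y e' => ha u v (h e) x y (h e')⟩

theorem SimpleGraph.IsPlanar.almostPlanar {V : Type*} {G : SimpleGraph V} (hG : G.IsPlanar) :
    AlmostPlanar G := by
  obtain ⟨p, a, hp, -, -, -, ha⟩ := hG
  let φ := Complex.equivRealProdCLM.symm
  refine ⟨fun v => φ (p v), fun u v h => (a u v h).map φ.continuous, ?_⟩
  intro u v h x y h' hux huy hvx hvy
  rw [Set.disjoint_left]
  rintro _ ⟨s, rfl⟩ ⟨t, ht⟩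
  have ht : a x y h' t = a u v h s := φ.injective ht
  have := ha u v h x y h' (by simp [hux, huy]) ⟨⟨s, rfl⟩, ⟨t, ht⟩⟩
  obtain ⟨h1, h2⟩ := this
  simp only [Set.mem_insert_iff, Set.mem_singleton_iff] at h1 h2
  rcases h1 with h1 | h1 <;> rcases h2 with h2 | h2 <;> rw [h1] at h2 <;>
    have := hp h2 <;> contradiction

theorem AlmostPlanar.cliqueFree {V : Type*} {G : SimpleGraph V} (hG : AlmostPlanar G) :
    G.CliqueFree 5 := by
  by_contra hc
  let φ := SimpleGraph.topEmbeddingOfNotCliqueFree hc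
  obtain ⟨p, a, ha⟩ := hG
  have hadj : ∀ i j : Fin 5, i < j → G.Adj (φ i) (φ j) := fun i j hij =>
    φ.map_rel_iff.2 hij.ne
  refine no_k5 (fun i => p (φ i)) (fun i j hij => a _ _ (hadj i j hij)) ?_
  intro i j k l hij hkl h1 h2 h3 h4 s t hst
  have := ha _ _ (hadj i j hij) _ _ (hadj k l hkl) (φ.injective.ne h1) (φ.injective.ne h2)
    (φ.injective.ne h3) (φ.injective.ne h4)
  exact Set.disjoint_left.1 this ⟨s, rfl⟩ ⟨t, hst.symm⟩

/-- Contraction of the edge `uv` into the vertex `u`. -/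
def contractInto {V : Type*} (G : SimpleGraph V) (u v : V) : SimpleGraph V where
  Adj x y := x ≠ y ∧ x ≠ v ∧ y ≠ v ∧ (G.Adj x y ∨ (x = u ∧ G.Adj v y) ∨ (y = u ∧ G.Adj v x))
  symm := ⟨by
    rintro x y ⟨h1, h2, h3, h4⟩
    refine ⟨h1.symm, h3, h2, ?_⟩
    rcases h4 with h | h | h
    · exact Or.inl h.symm
    · exact Or.inr (Or.inr h)
    · exact Or.inr (Or.inl h)⟩
  loopless := ⟨fun x h => h.1 rfl⟩

theorem AlmostPlanar.contractInto {V : Type*} {G : SimpleGraph V} (hG : AlmostPlanar G)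
    {u v : V} (huv : G.Adj u v) : AlmostPlanar (contractInto G u v) := by
  obtain ⟨p, a, ha⟩ := hG
  have key : ∀ x y, (_root_.contractInto G u v).Adj x y → ∃ γ : _root_.Path (p x) (p y),
      (∃ h : G.Adj x y, Set.range γ = Set.range (a x y h)) ∨
      (x = u ∧ ∃ h : G.Adj v y, Set.range γ = Set.range (a u v huv) ∪ Set.range (a v y h)) ∨
      (y = u ∧ ∃ h : G.Adj x v,
        Set.range γ = Set.range (a x v h) ∪ Set.range (a v u huv.symm)) := by
    rintro x y ⟨-, -, -, h | ⟨rfl, h⟩ | ⟨rfl, h⟩⟩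
    · exact ⟨a x y h, Or.inl ⟨h, rfl⟩⟩
    · exact ⟨(a x v huv).trans (a v y h), Or.inr (Or.inl ⟨rfl, h, Path.trans_range _ _⟩)⟩
    · exact ⟨(a x v h.symm).trans (a v y huv.symm),
        Or.inr (Or.inr ⟨rfl, h.symm, Path.trans_range _ _⟩)⟩
  choose b hb using key
  refine ⟨p, b, ?_⟩
  intro x y h x' y' h' h1 h2 h3 h4
  have hv1 := h.2.1
  have hv2 := h.2.2.1
  have hv3 := h'.2.1
  have hv4 := h'.2.2.1
  rcases hb x y h with ⟨e, he⟩ | ⟨e0, e, he⟩ | ⟨e0, e, he⟩ <;>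
  rcases hb x' y' h' with ⟨f, hf⟩ | ⟨f0, f, hf⟩ | ⟨f0, f, hf⟩ <;> rw [he, hf]
  · exact ha _ _ _ _ _ _ h1 h2 h3 h4
  · subst f0
    exact Set.disjoint_union_right.2 ⟨ha _ _ _ _ _ _ h1 hv1 h3 hv2, ha _ _ _ _ _ _ hv1 h2 hv2 h4⟩
  · subst f0
    exact Set.disjoint_union_right.2 ⟨ha _ _ _ _ _ _ h1 hv1 h3 hv2, ha _ _ _ _ _ _ hv1 h2 hv2 h4⟩
  · subst e0
    exact Set.disjoint_union_left.2 ⟨ha _ _ _ _ _ _ h1 h2 hv3.symm hv4.symm,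
      ha _ _ _ _ _ _ hv3.symm hv4.symm h3 h4⟩
  · exact absurd (e0.trans f0.symm) h1
  · exact absurd (e0.trans f0.symm) h2
  · subst e0
    exact Set.disjoint_union_left.2 ⟨ha _ _ _ _ _ _ h1 h2 hv3.symm hv4.symm,
      ha _ _ _ _ _ _ hv3.symm hv4.symm h3 h4⟩
  · exact absurd (e0.trans f0.symm) h3
  · exact absurd (e0.trans f0.symm) h4

theorem edgeFinset_card_eq_ncard {V : Type*} (G : SimpleGraph V) [Fintype G.edgeSet] :
    G.edgeFinset.card = G.edgeSet.ncard :=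
  (Set.ncard_eq_toFinset_card' _).symm

open Classical in
theorem card_contractInto {V : Type*} [Fintype V] (G : SimpleGraph V)
    {u v : V} (huv : G.Adj u v) :
    G.edgeFinset.card ≤ (contractInto G u v).edgeFinset.card + 1 +
      (G.neighborFinset u ∩ G.neighborFinset v).card := by
  set N := (G.neighborFinset v \ G.neighborFinset u).erase u with hN
  have h1 := G.card_edgeFinset_deleteIncidenceSet v
  have hdeg : G.degree v ≤ N.card + 1 + (G.neighborFinset u ∩ G.neighborFinset v).card := by
    have e1 : N.card + 1 = (G.neighborFinset v \ G.neighborFinset u).card := by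
      apply Finset.card_erase_add_one
      simp [huv.symm]
    rw [e1, Finset.inter_comm, Finset.card_sdiff_add_card_inter, G.card_neighborFinset_eq_degree]
  have hsub : (G.deleteIncidenceSet v).edgeFinset ∪ N.image (fun y => s(u, y)) ⊆
      (contractInto G u v).edgeFinset := by
    intro e he
    induction e with | _ x y
    simp only [Finset.mem_union, SimpleGraph.mem_edgeFinset, SimpleGraph.mem_edgeSet,
      Finset.mem_image, SimpleGraph.deleteIncidenceSet_adj] at he ⊢
    rcases he with ⟨h, hx, hy⟩ | ⟨z, hz, hzz⟩
    · exact ⟨h.ne, hx, hy, Or.inl h⟩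
    · rw [← SimpleGraph.mem_edgeSet, ← hzz, SimpleGraph.mem_edgeSet]
      simp [hN] at hz
      exact ⟨fun h => hz.1 h.symm, huv.ne, hz.2.1.ne', Or.inr (Or.inl ⟨rfl, hz.2.1⟩)⟩
  have hdisj : Disjoint (G.deleteIncidenceSet v).edgeFinset (N.image (fun y => s(u, y))) := by
    rw [Finset.disjoint_right]
    intro e he he'
    obtain ⟨y, hy, rfl⟩ := Finset.mem_image.1 he
    simp [SimpleGraph.deleteIncidenceSet_adj] at he'
    simp [hN] at hy
    exact hy.2.2 he'.1
  have hc := Finset.card_le_card hsub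
  rw [Finset.card_union_of_disjoint hdisj, Finset.card_image_of_injective] at hc
  · omega
  · intro y z hyz
    have hyz : s(u, y) = s(u, z) := hyz
    exact Sym2.congr_right.1 hyz

open Classical in
/-- The local structure around a vertex of small degree yields a contradiction. -/
theorem local_contra {V : Type*} [Fintype V] {G : SimpleGraph V} (hG : AlmostPlanar G) (v : V)
    (h4 : 4 ≤ G.degree v) (h5 : G.degree v ≤ 5)
    (hcom : ∀ x, G.Adj v x → 3 ≤ (G.neighborFinset v ∩ G.neighborFinset x).card) : False := by
  set N := G.neighborFinset v with hN
  have hcard : N.card = G.degree v := G.card_neighborFinset_eq_degree v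
  have hmem : ∀ x, x ∈ N ↔ G.Adj v x := by simp [hN]
  -- at most one non-neighbour
  have honly : ∀ x y z, x ∈ N → y ∈ N → z ∈ N → x ≠ y → x ≠ z → ¬ G.Adj x y → ¬ G.Adj x z →
      y = z := by
    intro x y z hx hy hz hxy hxz nxy nxz
    by_contra hyz
    have h3 := hcom x ((hmem x).1 hx)
    have hsub : N ∩ G.neighborFinset x ⊆ ((N.erase x).erase y).erase z := by
      intro w hw
      simp only [Finset.mem_inter, SimpleGraph.mem_neighborFinset] at hw
      simp only [Finset.mem_erase]
      refine ⟨?_, ?_, hw.2.ne', hw.1⟩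
      · rintro rfl; exact nxz hw.2
      · rintro rfl; exact nxy hw.2
    have := Finset.card_le_card hsub
    rw [Finset.card_erase_of_mem, Finset.card_erase_of_mem, Finset.card_erase_of_mem hx] at this
    · omega
    · simp [hxy.symm, hy]
    · simp [Ne.symm hyz, hxz.symm, hz]
  by_cases hcl : ∀ x ∈ N, ∀ y ∈ N, x ≠ y → G.Adj x y
  · obtain ⟨T, hTN, hT⟩ := Finset.exists_subset_card_eq (show 4 ≤ N.card by omega)
    refine hG.cliqueFree (insert v T) (SimpleGraph.IsNClique.insert ⟨?_, hT⟩ ?_)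
    · intro x hx y hy hxy
      exact hcl x (hTN hx) y (hTN hy) hxy
    · intro b hb
      exact (hmem b).1 (hTN hb)
  · push Not at hcl
    obtain ⟨a, ha, b, hb, hab, nab⟩ := hcl
    have h3 := hcom a ((hmem a).1 ha)
    have hsub : N ∩ G.neighborFinset a ⊆ (N.erase a).erase b := by
      intro w hw
      simp only [Finset.mem_inter, SimpleGraph.mem_neighborFinset] at hw
      simp only [Finset.mem_erase]
      refine ⟨?_, hw.2.ne', hw.1⟩
      rintro rfl; exact nab hw.2
    have h3' := h3.trans (Finset.card_le_card hsub)
    obtain ⟨T, hTN, hT⟩ := Finset.exists_subset_card_eq h3'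
    obtain ⟨x, y, z, hxy, hxz, hyz, rfl⟩ := Finset.card_eq_three.1 hT
    have hx := hTN (show x ∈ ({x, y, z} : Finset V) by simp)
    have hy := hTN (show y ∈ ({x, y, z} : Finset V) by simp)
    have hz := hTN (show z ∈ ({x, y, z} : Finset V) by simp)
    simp only [Finset.mem_erase] at hx hy hz
    -- pick `w` adjacent to both others
    have main : ∀ c d w, c ≠ d → c ≠ w → d ≠ w → (c ≠ b ∧ c ≠ a ∧ c ∈ N) →
        (d ≠ b ∧ d ≠ a ∧ d ∈ N) → (w ≠ b ∧ w ≠ a ∧ w ∈ N) → G.Adj w d → False := by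
      rintro c d w hcd hcw hdw ⟨cb, ca, cN⟩ ⟨db, da, dN⟩ ⟨wb, wa, wN⟩ wd
      have Ha : ∀ t, t ≠ b → t ≠ a → t ∈ N → G.Adj a t := fun t tb ta tN => by
        by_contra hh
        exact tb (honly a t b ha tN hb ta.symm hab hh nab)
      have Hb : ∀ t, t ≠ b → t ≠ a → t ∈ N → G.Adj b t := fun t tb ta tN => by
        by_contra hh
        exact ta (honly b t a hb tN ha tb.symm hab.symm hh (fun h => nab h.symm))
      have hac := Ha c cb ca cN
      have Hv := fun t => (hmem t).1
      have cv : v ≠ c := (Hv c cN).ne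
      have lift : ∀ s t, G.Adj s t → s ≠ c → t ≠ c → (contractInto G a c).Adj s t :=
        fun s t h hs ht => ⟨h.ne, hs, ht, Or.inl h⟩
      refine (hG.contractInto hac).cliqueFree {a, b, d, v, w} ?_
      have e1 : (contractInto G a c).Adj a b :=
        ⟨hab, ca.symm, cb.symm, Or.inr (Or.inl ⟨rfl, (Hb c cb ca cN).symm⟩)⟩
      have e2 := lift a d (Ha d db da dN) ca.symm hcd.symm
      have e3 := lift a v (Hv a ha).symm ca.symm cv
      have e4 := lift a w (Ha w wb wa wN) ca.symm hcw.symm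
      have e5 := lift b d (Hb d db da dN) cb.symm hcd.symm
      have e6 := lift b v (Hv b hb).symm cb.symm cv
      have e7 := lift b w (Hb w wb wa wN) cb.symm hcw.symm
      have e8 := lift d v (Hv d dN).symm hcd.symm cv
      have e9 := lift d w wd.symm hcd.symm hcw.symm
      have e10 := lift v w (Hv w wN) cv hcw.symm
      have s0 : (contractInto G a c).IsNClique 1 {w} := by simp
      refine SimpleGraph.IsNClique.insert (SimpleGraph.IsNClique.insert
        (SimpleGraph.IsNClique.insert (SimpleGraph.IsNClique.insert s0 ?_) ?_) ?_) ?_ <;>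
        simp only [Finset.mem_insert, Finset.mem_singleton, forall_eq_or_imp, forall_eq] <;> tauto
    by_cases hadj : G.Adj z y
    · exact main x y z hxy hxz hyz hx hy hz hadj
    · refine main y z x hyz hxy.symm hxz.symm hy hz hx ?_
      by_contra hh
      exact hxy (honly z x y hz.2.2 hx.2.2 hy.2.2 hxz.symm hyz.symm (fun h => hh h.symm) hadj)

open Classical in
theorem card_edges_aux {V : Type*} [Fintype V] (n : ℕ) (hn : 3 ≤ n) :
    ∀ (S : Finset V) (G : SimpleGraph V), S.card = n → AlmostPlanar G →
      (∀ x y, G.Adj x y → x ∈ S) → G.edgeFinset.card + 6 ≤ 3 * n := by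
  have hsum : ∀ (S : Finset V) (G : SimpleGraph V), (∀ x y, G.Adj x y → x ∈ S) →
      ∑ v ∈ S, G.degree v = 2 * G.edgeFinset.card := by
    intro S G hS
    rw [← G.sum_degrees_eq_twice_card_edges]
    apply Finset.sum_subset (Finset.subset_univ _)
    intro x _ hx
    rw [← G.card_neighborFinset_eq_degree, Finset.card_eq_zero, Finset.eq_empty_iff_forall_notMem]
    intro y hy
    exact hx (hS x y ((G.mem_neighborFinset x y).1 hy))
  induction n, hn using Nat.le_induction with
  | base =>
    intro S G hc _ hS
    have h1 := hsum S G hS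
    have h2 : ∑ v ∈ S, G.degree v ≤ ∑ v ∈ S, 2 := by
      refine Finset.sum_le_sum fun v hv => ?_
      rw [← G.card_neighborFinset_eq_degree]
      have : G.neighborFinset v ⊆ S.erase v := by
        intro y hy
        have hy := (G.mem_neighborFinset v y).1 hy
        exact Finset.mem_erase.2 ⟨hy.ne', hS y v hy.symm⟩
      refine (Finset.card_le_card this).trans ?_
      rw [Finset.card_erase_of_mem hv, hc]
    simp [hc] at h2
    omega
  | succ n hn ih =>
    intro S G' hc hG' hS'
    by_contra hcon
    obtain ⟨T, hT, hTc⟩ := Finset.exists_subset_card_eq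
      (show 3 * (n + 1) - 5 ≤ G'.edgeFinset.card by omega)
    obtain ⟨G, hGle, hGcard⟩ : ∃ G : SimpleGraph V, G ≤ G' ∧
        G.edgeFinset.card = 3 * (n + 1) - 5 := by
      refine ⟨SimpleGraph.fromEdgeSet (T : Set (Sym2 V)), ?_, ?_⟩
      · intro x y hxy
        rw [SimpleGraph.fromEdgeSet_adj] at hxy
        simpa using hT hxy.1
      · rw [← hTc, edgeFinset_card_eq_ncard, ← Set.ncard_coe_finset]
        congr 1
        ext e
        rw [SimpleGraph.edgeSet_fromEdgeSet]
        constructor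
        · intro h; exact h.1
        · intro h
          refine ⟨h, ?_⟩
          exact G'.not_isDiag_of_mem_edgeFinset (hT h)
    have hG := hG'.mono hGle
    have hS : ∀ x y, G.Adj x y → x ∈ S := fun x y h => hS' x y (hGle h)
    have hdeg : ∀ v ∈ S, 4 ≤ G.degree v := by
      intro v hv
      by_contra hlt
      have h1 := ih (S.erase v) (G.deleteIncidenceSet v)
        (by rw [Finset.card_erase_of_mem hv, hc]; rfl)
        (hG.mono (G.deleteIncidenceSet_le v)) (by
          intro x y hxy
          rw [SimpleGraph.deleteIncidenceSet_adj] at hxy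
          exact Finset.mem_erase.2 ⟨hxy.2.1, hS x y hxy.1⟩)
      have h2 := G.card_edgeFinset_deleteIncidenceSet v
      simp only [edgeFinset_card_eq_ncard] at h1 h2 hGcard
      omega
    have hcom : ∀ u v, G.Adj u v → 3 ≤ (G.neighborFinset u ∩ G.neighborFinset v).card := by
      intro u v huv
      by_contra hlt
      have hv := hS v u huv.symm
      have h1 := ih (S.erase v) (contractInto G u v)
        (by rw [Finset.card_erase_of_mem hv, hc]; rfl)
        (hG.contractInto huv) (by
          rintro x y ⟨-, h2, -, h4⟩
          refine Finset.mem_erase.2 ⟨h2, ?_⟩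
          rcases h4 with h | ⟨rfl, h⟩ | ⟨-, h⟩
          · exact hS x y h
          · exact hS x v huv
          · exact hS x v h.symm)
      have h2 := card_contractInto G huv
      omega
    obtain ⟨v, hv, hv5⟩ : ∃ v ∈ S, G.degree v ≤ 5 := by
      by_contra hno
      push Not at hno
      have h1 := hsum S G hS
      have h2 : ∑ v ∈ S, 6 ≤ ∑ v ∈ S, G.degree v := Finset.sum_le_sum fun v hv => hno v hv
      simp [hc] at h2
      omega
    exact local_contra hG v (hdeg v hv) hv5 (fun x hx => hcom v x hx)

/-- A simple planar graph on `n ≥ 3` vertices having an independent set `I₂` of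
vertices of degree `2` has at most `(3n - 6) - (|I₂| - 1)` edges. -/
theorem card_edges_le_of_indep_degree_two
    {V : Type*} [Fintype V] [DecidableEq V]
    (G : SimpleGraph V) [DecidableRel G.Adj]
    (hplanar : G.IsPlanar) (hn : 3 ≤ Fintype.card V)
    (I₂ : Finset V) (hindep : ∀ u ∈ I₂, ∀ v ∈ I₂, ¬ G.Adj u v)
    (hdeg : ∀ v ∈ I₂, G.degree v = 2) :
    (G.edgeFinset.card : ℤ) ≤ (3 * Fintype.card V - 6) - (I₂.card - 1) := by
  classical
  set S : Finset V := Finset.univ \ I₂ with hSdef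
  have hScard : S.card + I₂.card = Fintype.card V := by
    rw [hSdef, Finset.card_sdiff_add_card_eq_card (Finset.subset_univ _), Finset.card_univ]
  let H : SimpleGraph V :=
    { Adj := fun x y => G.Adj x y ∧ x ∈ S ∧ y ∈ S
      symm := ⟨fun x y h => ⟨h.1.symm, h.2.2, h.2.1⟩⟩
      loopless := ⟨fun x h => h.1.ne rfl⟩ }
  have hHG : H ≤ G := fun x y h => h.1
  have hcount : G.edgeFinset.card ≤ H.edgeFinset.card + 2 * I₂.card := by
    have hsub : G.edgeFinset ⊆ H.edgeFinset ∪ I₂.biUnion (fun v => G.incidenceFinset v) := by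
      intro e he
      induction e with | _ x y
      simp only [SimpleGraph.mem_edgeFinset, SimpleGraph.mem_edgeSet] at he
      simp only [Finset.mem_union, SimpleGraph.mem_edgeFinset, SimpleGraph.mem_edgeSet,
        Finset.mem_biUnion, SimpleGraph.mem_incidenceFinset]
      by_cases hx : x ∈ I₂
      · exact Or.inr ⟨x, hx, he, by simp⟩
      by_cases hy : y ∈ I₂
      · exact Or.inr ⟨y, hy, he, by simp⟩
      · exact Or.inl ⟨he, by simp [hSdef, hx], by simp [hSdef, hy]⟩
    refine (Finset.card_le_card hsub).trans ((Finset.card_union_le _ _).trans ?_)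
    refine Nat.add_le_add_left ?_ _
    rw [mul_comm]
    refine Finset.card_biUnion_le_card_mul _ _ _ fun v hv => ?_
    rw [SimpleGraph.card_incidenceFinset_eq_degree, hdeg v hv]
  have hHS : ∀ x y, H.Adj x y → x ∈ S := fun x y h => h.2.1
  rcases Nat.lt_or_ge S.card 3 with hlt | hge
  · -- few vertices outside `I₂`
    have hpos : 0 < I₂.card := by omega
    obtain ⟨v, hv⟩ := Finset.card_pos.1 hpos
    have hNS : G.neighborFinset v ⊆ S := by
      intro w hw
      have hw := (G.mem_neighborFinset v w).1 hw
      simp only [hSdef, Finset.mem_sdiff, Finset.mem_univ, true_and]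
      exact fun hwI => hindep v hv w hwI hw
    have h2 : 2 ≤ S.card := by
      have := Finset.card_le_card hNS
      rwa [G.card_neighborFinset_eq_degree, hdeg v hv] at this
    have hS2 : S.card = 2 := by omega
    obtain ⟨s, t, hst, hSst⟩ := Finset.card_eq_two.1 hS2
    have hH1 : H.edgeFinset.card ≤ 1 := by
      have hsub : H.edgeFinset ⊆ {s(s, t)} := by
        intro e he
        induction e with | _ x y
        simp only [SimpleGraph.mem_edgeFinset, SimpleGraph.mem_edgeSet] at he
        have hne := he.1.ne
        have hx := he.2.1
        have hy := he.2.2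
        rw [hSst] at hx hy
        simp only [Finset.mem_insert, Finset.mem_singleton] at hx hy ⊢
        rcases hx with rfl | rfl <;> rcases hy with rfl | rfl
        · exact absurd rfl hne
        · rfl
        · exact Sym2.eq_swap
        · exact absurd rfl hne
      simpa using Finset.card_le_card hsub
    omega
  · have := card_edges_aux S.card hge S H rfl (hplanar.almostPlanar.mono hHG) hHS
    simp only [edgeFinset_card_eq_ncard] at this hcount ⊢
    omega
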